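/- arXiv:math/0504165 — 4 statements merged into one kernel-verified Lean document; each statement's English description precedes it below -/
import Mathlib

section
/- Let X, Y, M be topological spaces, let f : X → Y be a local homeomorphism, and let Φ : M → X be a continuous surjection. If every fibre (f ∘ Φ)⁻¹({c}), c ∈ Y, is preconnected, then f is injective. (Abstract core of Proposition 'prop:diffeo': a local diffeomorphism f on the image of a momentum map Φ such that F = f ∘ Φ has connected fibres is globally injective, since each fibre f⁻¹(c) = Φ(F⁻¹(c)) is connected and discrete, hence a single point.) -/
/-- Abstract core of Proposition `prop:diffeo`: if `f : X → Y` is a local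
homeomorphism and `Φ : M → X` is a continuous surjection such that every fibre
of `f ∘ Φ` is preconnected, then `f` is injective. -/
theorem localHomeomorph_injective_of_preconnected_fibres
    {X Y M : Type*} [TopologicalSpace X] [TopologicalSpace Y] [TopologicalSpace M]
    (f : X → Y) (Φ : M → X)
    (hf : IsLocalHomeomorph f)
    (hΦcont : Continuous Φ) (hΦsurj : Function.Surjective Φ)
    (hfib : ∀ c : Y, IsPreconnected ((f ∘ Φ) ⁻¹' {c})) :
    Function.Injective f := by
  intro a b hab
  by_contra hne
  have hS : IsPreconnected (f ⁻¹' {f a}) := by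
    have h := (hfib (f a)).image Φ hΦcont.continuousOn
    rwa [Set.preimage_comp, Set.image_preimage_eq _ hΦsurj] at h
  choose e he hfe using hf
  have hinj : ∀ x y, y ∈ (e x).source → f y = f x → y = x := by
    intro x y hy hxy
    apply (e x).injOn hy (he x)
    rw [← hfe x]
    exact hxy
  obtain ⟨z, hz, hzU, hzV⟩ := hS (e a).source (⋃ x ∈ {x | f x = f a ∧ x ≠ a}, (e x).source)
    (e a).open_source (isOpen_biUnion fun x _ => (e x).open_source)
    (by
      intro x hx
      by_cases h : x = a
      · left
        rw [h]
        exact he a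
      · right
        exact Set.mem_biUnion (show x ∈ {x | f x = f a ∧ x ≠ a} from ⟨hx, h⟩) (he x))
    ⟨a, rfl, he a⟩
    ⟨b, hab.symm, Set.mem_biUnion
      (show b ∈ {x | f x = f a ∧ x ≠ a} from ⟨hab.symm, fun h => hne h.symm⟩) (he b)⟩
  have hza : z = a := hinj a z hzU hz
  subst hza
  obtain ⟨x, ⟨hx1, hx2⟩, hzx⟩ := Set.mem_iUnion₂.1 hzV
  exact hx2 (hinj x z hzx hx1.symm).symm
end

section
/- Let x₀ ∈ ℝ, n ∈ ℤ, and let p = (p₁, p₂), q = (q₁, q₂) ∈ ℝ² with x₀ ≤ p₁ < q₁ (so the closed segment [p, q] is non-vertical and contained in the closed half-plane {x ≥ x₀}). If the image of the segment [p, q] under the vertical shear t_{n,x₀} equals [p, q], then n = 0. (This is the key step in the proof of Proposition 'prop:group' that the subgroup of affine transformations generated by t_L acts freely on the set of non-vertical segments starting on the right of the line L, whence the freeness of the group action on the set of moment polygons when the focus-focus abscissae are pairwise distinct.) -/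
/-- The vertical shear `t_{n,x₀}(x, y) = (x, y + n · max (x − x₀) 0)`. -/
noncomputable def shear (n : ℤ) (x₀ : ℝ) : ℝ × ℝ → ℝ × ℝ :=
  fun p => (p.1, p.2 + (n : ℝ) * max (p.1 - x₀) 0)

/-- Freeness step in Proposition `prop:group`: if a non-vertical closed segment
`[p, q]` lying in the closed right half-plane `{x ≥ x₀}` is mapped onto itself by
the vertical shear `t_{n,x₀}`, then `n = 0`. -/
theorem shear_fixes_segment_iff_zero
    (x₀ : ℝ) (n : ℤ) (p q : ℝ × ℝ) (hp : x₀ ≤ p.1) (hpq : p.1 < q.1)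
    (hseg : shear n x₀ '' segment ℝ p q = segment ℝ p q) :
    n = 0 := by
  have hq : shear n x₀ q ∈ segment ℝ p q := by
    rw [← hseg]
    exact ⟨q, right_mem_segment ℝ p q, rfl⟩
  obtain ⟨a, b, ha, hb, hab, h⟩ := hq
  have h1 : a * p.1 + b * q.1 = q.1 := by simpa [shear] using congrArg Prod.fst h
  have h2 : a * p.2 + b * q.2 = q.2 + (n : ℝ) * max (q.1 - x₀) 0 := by
    simpa [shear] using congrArg Prod.snd h
  have hb' : b = 1 - a := by linarith
  subst hb'
  have ha0 : a = 0 := by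
    have h3 : a * (q.1 - p.1) = 0 := by linarith
    rcases mul_eq_zero.mp h3 with h4 | h4
    · exact h4
    · linarith
  subst ha0
  rw [max_eq_left (by linarith)] at h2
  have h5 : (n : ℝ) * (q.1 - x₀) = 0 := by linarith
  rcases mul_eq_zero.mp h5 with h6 | h6
  · exact_mod_cast h6
  · linarith
end

section
/- Let N ≥ 1, let x₀ < x₁ < ⋯ < x_N be real numbers, and set h_i = x_{i+1} − x_i for 0 ≤ i ≤ N−1. Let y_i⁻, y_i⁺ (0 ≤ i ≤ N) and α_i⁻, α_i⁺ (0 ≤ i ≤ N−1) be real numbers with y_{i+1}^± = y_i^± + h_i·α_i^±, and assume that for each i one has max(y_i⁻, y_{i+1}⁻) ≤ min(y_i⁺, y_{i+1}⁺). Let ℓ⁻, ℓ⁺ be the piecewise linear functions on [x₀, x_N] with ℓ^±(x) = y_i^± + α_i^±(x − x_i) for x ∈ [x_i, x_{i+1}], and let P = {(x, y) : x₀ ≤ x ≤ x_N and ℓ⁻(x) ≤ y ≤ ℓ⁺(x)}. Then for every y ∈ ℝ not belonging to the finite set {y_i⁻, y_i⁺ : 0 ≤ i ≤ N}, the one-dimensional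 Lebesgue measure ρ(y) of the horizontal slice {x ∈ ℝ : (x, y) ∈ P} is given by ρ(y) = Σ_{i=0}^{N−1} [ |α_i⁻|⁻¹·(y − y_i⁻)·𝟙⟦y_i⁻, y_{i+1}⁻⟧(y) + h_i·𝟙⟦y_{i+1}⁻, y_i⁺⟧(y) + |α_i⁺|⁻¹·(y_{i+1}⁺ − y)·𝟙⟦y_i⁺, y_{i+1}⁺⟧(y) ], where ⟦a, b⟧ denotes the interval [min(a,b), max(a,b)], 𝟙_I is the characteristic function of I, and any term whose slope α_i^± vanishes is zero (its interval ⟦y_i^±, y_{i+1}^±⟧ is then a single point not containing y). (This is the formula of the final theorem of the paper for the Duistermaat–Heckman function ρ_K of the second action variable K, computed as the length of the horizontal slice of the generalised moment polygon at ordinate y.) -/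
open MeasureTheory Set

lemma aff_le {a b t m α y : ℝ} (h1 : a ≤ t) (h2 : t ≤ b) (hm : m ≤ y)
    (hm' : m + (b - a) * α ≤ y) : m + α * (t - a) ≤ y := by
  rcases le_total α 0 with h | h
  · nlinarith [mul_nonneg (neg_nonneg.2 h) (sub_nonneg.2 h1)]
  · nlinarith [mul_nonneg h (sub_nonneg.2 h2)]

lemma aff_lt {a b t m α y : ℝ} (h1 : a ≤ t) (h2 : t ≤ b) (hm : m < y)
    (hm' : m + (b - a) * α < y) : m + α * (t - a) < y := by
  rcases le_total α 0 with h | h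
  · nlinarith [mul_nonneg (neg_nonneg.2 h) (sub_nonneg.2 h1)]
  · nlinarith [mul_nonneg h (sub_nonneg.2 h2)]

lemma le_aff {a b t m α y : ℝ} (h1 : a ≤ t) (h2 : t ≤ b) (hm : y ≤ m)
    (hm' : y ≤ m + (b - a) * α) : y ≤ m + α * (t - a) := by
  have := aff_le (m := -m) (α := -α) (y := -y) h1 h2 (by linarith) (by linarith)
  linarith

lemma lt_aff {a b t m α y : ℝ} (h1 : a ≤ t) (h2 : t ≤ b) (hm : y < m)
    (hm' : y < m + (b - a) * α) : y < m + α * (t - a) := by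
  have := aff_lt (m := -m) (α := -α) (y := -y) h1 h2 (by linarith) (by linarith)
  linarith

lemma vol_Icc_of_eq {S : Set ℝ} {u v r : ℝ} (h : S = Icc u v) (huv : u ≤ v) (hr : v - u = r) :
    (volume S).toReal = r := by
  rw [h, Real.volume_Icc, ENNReal.toReal_ofReal (by linarith), hr]

lemma piece (a b m m' p p' α β y : ℝ) (hab : a < b) (hm : m' = m + (b - a) * α)
    (hp : p' = p + (b - a) * β) (hmp : max m m' ≤ min p p')
    (h1 : y ≠ m) (h2 : y ≠ m') (h3 : y ≠ p) (h4 : y ≠ p') :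
    (volume {t : ℝ | a ≤ t ∧ t ≤ b ∧ m + α * (t - a) ≤ y ∧ y ≤ p + β * (t - a)}).toReal =
      (Set.uIcc m m').indicator (fun _ => |α|⁻¹ * (y - m)) y
          + (Set.uIcc m' p).indicator (fun _ => b - a) y
          + (Set.uIcc p p').indicator (fun _ => |β|⁻¹ * (p' - y)) y := by
  have q1 : m ≤ p := (le_max_left _ _).trans (hmp.trans (min_le_left _ _))
  have q2 : m ≤ p' := (le_max_left _ _).trans (hmp.trans (min_le_right _ _))
  have q3 : m' ≤ p := (le_max_right _ _).trans (hmp.trans (min_le_left _ _))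
  have q4 : m' ≤ p' := (le_max_right _ _).trans (hmp.trans (min_le_right _ _))
  classical
  simp only [Set.indicator_apply, Set.mem_uIcc]
  have hba : 0 < b - a := by linarith
  rcases lt_or_gt_of_ne h1 with h1 | h1 <;> rcases lt_or_gt_of_ne h2 with h2 | h2
  · skip
    rw [if_neg (by rintro (h | h) <;> linarith), if_neg (by rintro (h | h) <;> linarith),
      if_neg (by rintro (h | h) <;> linarith)]
    have : {t : ℝ | a ≤ t ∧ t ≤ b ∧ m + α * (t - a) ≤ y ∧ y ≤ p + β * (t - a)} = ∅ := by
      ext t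
      simp only [mem_ofPred_eq, mem_empty_iff_false, iff_false]
      rintro ⟨ha, hb, hc, -⟩
      have := lt_aff ha hb h1 (hm ▸ h2)
      linarith
    rw [this]; simp
  · skip
    rw [if_pos (Or.inr ⟨h2.le, h1.le⟩), if_pos (Or.inl ⟨h2.le, by linarith⟩),
      if_neg (by rintro (h | h) <;> linarith)]
    have hα : α < 0 := by
      by_contra h
      nlinarith [mul_nonneg hba.le (not_lt.1 h)]
    have hc : (y - m) / α * α = y - m := div_mul_cancel₀ _ hα.ne
    have hc' : |α|⁻¹ * (y - m) = -((y - m) / α) := by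
      rw [abs_of_neg hα]; field_simp
    rw [hc']
    generalize (y - m) / α = c at hc
    have hcb : c ≤ b - a := by by_contra h; nlinarith
    have hc0 : 0 ≤ c := by by_contra h; nlinarith
    refine vol_Icc_of_eq (u := a + c) (v := b) ?_ (by linarith) (by ring)
    ext t
    simp only [mem_ofPred_eq, mem_Icc]
    constructor
    · rintro ⟨ha, hb, hd, -⟩
      refine ⟨?_, hb⟩
      by_contra h
      nlinarith
    · rintro ⟨ha, hb⟩
      refine ⟨by linarith, hb, by nlinarith, ?_⟩
      exact le_aff (b := b) (by linarith) hb (by linarith) (by linarith)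
  · skip
    rw [if_pos (Or.inl ⟨h1.le, h2.le⟩), if_neg (by rintro (h | h) <;> linarith),
      if_neg (by rintro (h | h) <;> linarith)]
    have hα : 0 < α := by
      by_contra h
      nlinarith [mul_nonneg hba.le (neg_nonneg.2 (not_lt.1 h))]
    have hc : (y - m) / α * α = y - m := div_mul_cancel₀ _ hα.ne'
    have hc' : |α|⁻¹ * (y - m) = (y - m) / α := by
      rw [abs_of_pos hα]; field_simp
    rw [hc']
    generalize (y - m) / α = c at hc
    have hcb : c ≤ b - a := by by_contra h; nlinarith
    have hc0 : 0 ≤ c := by by_contra h; nlinarith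
    refine vol_Icc_of_eq (u := a) (v := a + c) ?_ (by linarith) (by ring)
    ext t
    simp only [mem_ofPred_eq, mem_Icc]
    constructor
    · rintro ⟨ha, hb, hd, -⟩
      refine ⟨ha, ?_⟩
      by_contra h
      nlinarith
    · rintro ⟨ha, hb⟩
      refine ⟨ha, by linarith, by nlinarith, ?_⟩
      exact le_aff (b := b) ha (by linarith) (by linarith) (by linarith)
  have hl : ∀ t, a ≤ t → t ≤ b → m + α * (t - a) ≤ y := fun t ha hb =>
    aff_le ha hb h1.le (hm ▸ h2.le)
  rw [if_neg (by rintro (h | h) <;> linarith)]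
  rcases lt_or_gt_of_ne h3 with h3 | h3 <;> rcases lt_or_gt_of_ne h4 with h4 | h4
  · skip
    rw [if_pos (Or.inl ⟨h2.le, h3.le⟩), if_neg (by rintro (h | h) <;> linarith)]
    refine vol_Icc_of_eq (u := a) (v := b) ?_ hab.le (by ring)
    ext t
    simp only [mem_ofPred_eq, mem_Icc]
    exact ⟨fun h => ⟨h.1, h.2.1⟩, fun h => ⟨h.1, h.2, hl t h.1 h.2,
      le_aff h.1 h.2 h3.le (hp ▸ h4.le)⟩⟩
  · skip
    rw [if_pos (Or.inl ⟨h2.le, h3.le⟩), if_pos (Or.inr ⟨h4.le, h3.le⟩)]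
    have hβ : β < 0 := by
      by_contra h
      nlinarith [mul_nonneg hba.le (not_lt.1 h)]
    have hc : (y - p) / β * β = y - p := div_mul_cancel₀ _ hβ.ne
    have hc' : |β|⁻¹ * (p' - y) = (y - p) / β - (b - a) := by
      rw [abs_of_neg hβ, hp]; have := hβ.ne; field_simp; ring
    rw [hc']
    generalize (y - p) / β = c at hc
    have hcb : c ≤ b - a := by by_contra h; nlinarith
    have hc0 : 0 ≤ c := by by_contra h; nlinarith
    refine vol_Icc_of_eq (u := a) (v := a + c) ?_ (by linarith) (by ring)
    ext t
    simp only [mem_ofPred_eq, mem_Icc]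
    constructor
    · rintro ⟨ha, hb, -, hd⟩
      refine ⟨ha, ?_⟩
      by_contra h
      nlinarith
    · rintro ⟨ha, hb⟩
      exact ⟨ha, by linarith, hl t ha (by linarith), by nlinarith⟩
  · skip
    rw [if_neg (by rintro (h | h) <;> linarith), if_pos (Or.inl ⟨h3.le, h4.le⟩)]
    have hβ : 0 < β := by
      by_contra h
      nlinarith [mul_nonneg hba.le (neg_nonneg.2 (not_lt.1 h))]
    have hc : (y - p) / β * β = y - p := div_mul_cancel₀ _ hβ.ne'
    have hc' : |β|⁻¹ * (p' - y) = (b - a) - (y - p) / β := by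
      rw [abs_of_pos hβ, hp]; field_simp; ring
    rw [hc']
    generalize (y - p) / β = c at hc
    have hcb : c ≤ b - a := by by_contra h; nlinarith
    have hc0 : 0 ≤ c := by by_contra h; nlinarith
    refine vol_Icc_of_eq (u := a + c) (v := b) ?_ (by linarith) (by ring)
    ext t
    simp only [mem_ofPred_eq, mem_Icc]
    constructor
    · rintro ⟨ha, hb, -, hd⟩
      refine ⟨?_, hb⟩
      by_contra h
      nlinarith
    · rintro ⟨ha, hb⟩
      exact ⟨by linarith, hb, hl t (by linarith) hb, by nlinarith⟩
  · skip
    rw [if_neg (by rintro (h | h) <;> linarith), if_neg (by rintro (h | h) <;> linarith)]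
    have : {t : ℝ | a ≤ t ∧ t ≤ b ∧ m + α * (t - a) ≤ y ∧ y ≤ p + β * (t - a)} = ∅ := by
      ext t
      simp only [mem_ofPred_eq, mem_empty_iff_false, iff_false]
      rintro ⟨ha, hb, -, hc⟩
      have := aff_lt ha hb h3 (hp ▸ h4)
      linarith
    rw [this]; simp

/-- The Duistermaat–Heckman slice formula (final theorem of the paper): for a
generalised moment polygon `P` bounded below and above by piecewise linear
functions `ℓ⁻, ℓ⁺` with vertices at abscissae `x 0 < ⋯ < x N`, ordinates `y_i^±`
and slopes `α_i^±` (so `y_{i+1}^± = y_i^± + h_i α_i^±` with `h_i = x_{i+1} - x_i`),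
the length `ρ(y)` of the horizontal slice of `P` at any height `y` avoiding the
vertex ordinates is
`ρ(y) = Σ_i |α_i⁻|⁻¹ (y − y_i⁻) 𝟙⟦y_i⁻,y_{i+1}⁻⟧(y) + h_i 𝟙⟦y_{i+1}⁻,y_i⁺⟧(y)
        + |α_i⁺|⁻¹ (y_{i+1}⁺ − y) 𝟙⟦y_i⁺,y_{i+1}⁺⟧(y)`. -/
theorem DH_slice_length_formula
    (N : ℕ) (hN : 1 ≤ N) (x ym yp am ap : ℕ → ℝ)
    (hx : ∀ i < N, x i < x (i + 1))
    (hym : ∀ i < N, ym (i + 1) = ym i + (x (i + 1) - x i) * am i)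
    (hyp : ∀ i < N, yp (i + 1) = yp i + (x (i + 1) - x i) * ap i)
    (hband : ∀ i < N, max (ym i) (ym (i + 1)) ≤ min (yp i) (yp (i + 1)))
    (ℓm ℓp : ℝ → ℝ)
    (hℓm : ∀ i < N, ∀ t ∈ Set.Icc (x i) (x (i + 1)), ℓm t = ym i + am i * (t - x i))
    (hℓp : ∀ i < N, ∀ t ∈ Set.Icc (x i) (x (i + 1)), ℓp t = yp i + ap i * (t - x i))
    (y : ℝ) (hy : ∀ i ≤ N, y ≠ ym i ∧ y ≠ yp i) :
    (volume {t : ℝ | x 0 ≤ t ∧ t ≤ x N ∧ ℓm t ≤ y ∧ y ≤ ℓp t}).toReal =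
      ∑ i ∈ Finset.range N,
        ((Set.uIcc (ym i) (ym (i + 1))).indicator (fun _ => |am i|⁻¹ * (y - ym i)) y
          + (Set.uIcc (ym (i + 1)) (yp i)).indicator (fun _ => x (i + 1) - x i) y
          + (Set.uIcc (yp i) (yp (i + 1))).indicator (fun _ => |ap i|⁻¹ * (yp (i + 1) - y)) y) := by
  clear hN
  have mono : ∀ n ≤ N, x 0 ≤ x n := by
    intro n
    induction n with
    | zero => intro _; exact le_rfl
    | succ n ih => intro hn; exact (ih (by omega)).trans (hx n (by omega)).le
  suffices H : ∀ n ≤ N, (volume {t : ℝ | x 0 ≤ t ∧ t ≤ x n ∧ ℓm t ≤ y ∧ y ≤ ℓp t}).toReal =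
      ∑ i ∈ Finset.range n,
        ((Set.uIcc (ym i) (ym (i + 1))).indicator (fun _ => |am i|⁻¹ * (y - ym i)) y
          + (Set.uIcc (ym (i + 1)) (yp i)).indicator (fun _ => x (i + 1) - x i) y
          + (Set.uIcc (yp i) (yp (i + 1))).indicator (fun _ => |ap i|⁻¹ * (yp (i + 1) - y)) y) from
    H N le_rfl
  intro n
  induction n with
  | zero =>
    intro _
    have h0 : volume {t : ℝ | x 0 ≤ t ∧ t ≤ x 0 ∧ ℓm t ≤ y ∧ y ≤ ℓp t} = 0 := by
      refine measure_mono_null (t := {x 0}) ?_ (by simp)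
      rintro t ⟨h1, h2, -⟩
      exact le_antisymm h2 h1
    simp [h0]
  | succ n ih =>
    intro hn
    have hn' : n < N := by omega
    rw [Finset.sum_range_succ, ← ih hn'.le,
      ← piece (x n) (x (n + 1)) (ym n) (ym (n + 1)) (yp n) (yp (n + 1)) (am n) (ap n) y (hx n hn')
        (hym n hn') (hyp n hn') (hband n hn') (hy n hn'.le).1 (hy (n + 1) hn).1
        (hy n hn'.le).2 (hy (n + 1) hn).2]
    have hx0 := mono n hn'.le
    have hxn := hx n hn'
    have hU : {t : ℝ | x 0 ≤ t ∧ t ≤ x (n + 1) ∧ ℓm t ≤ y ∧ y ≤ ℓp t} =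
        {t : ℝ | x 0 ≤ t ∧ t ≤ x n ∧ ℓm t ≤ y ∧ y ≤ ℓp t} ∪
        {t : ℝ | x n ≤ t ∧ t ≤ x (n + 1) ∧ ym n + am n * (t - x n) ≤ y ∧
          y ≤ yp n + ap n * (t - x n)} := by
      ext t
      simp only [mem_ofPred_eq, mem_union]
      constructor
      · rintro ⟨h1, h2, h3, h4⟩
        rcases le_total t (x n) with h | h
        · exact Or.inl ⟨h1, h, h3, h4⟩
        · right
          rw [← hℓm n hn' t ⟨h, h2⟩, ← hℓp n hn' t ⟨h, h2⟩]
          exact ⟨h, h2, h3, h4⟩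
      · rintro (⟨h1, h2, h3, h4⟩ | ⟨h1, h2, h3, h4⟩)
        · exact ⟨h1, by linarith, h3, h4⟩
        · rw [← hℓm n hn' t ⟨h1, h2⟩] at h3
          rw [← hℓp n hn' t ⟨h1, h2⟩] at h4
          exact ⟨by linarith, h2, h3, h4⟩
    have hmeas : MeasurableSet {t : ℝ | x n ≤ t ∧ t ≤ x (n + 1) ∧ ym n + am n * (t - x n) ≤ y ∧
          y ≤ yp n + ap n * (t - x n)} := by
      have e1 : IsClosed {t : ℝ | ym n + am n * (t - x n) ≤ y} :=
        isClosed_le (by fun_prop) (by fun_prop)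
      have e2 : IsClosed {t : ℝ | y ≤ yp n + ap n * (t - x n)} :=
        isClosed_le (by fun_prop) (by fun_prop)
      convert ((isClosed_Icc (a := x n) (b := x (n + 1))).inter (e1.inter e2)).measurableSet using 1
      ext t
      simp only [mem_ofPred_eq, mem_inter_iff, mem_Icc, and_assoc]
    rw [hU, measure_union₀ hmeas.nullMeasurableSet, ENNReal.toReal_add]
    · refine ((measure_mono (t := Icc (x 0) (x n)) ?_).trans_lt measure_Icc_lt_top).ne
      exact fun t h => ⟨h.1, h.2.1⟩
    · refine ((measure_mono (t := Icc (x n) (x (n + 1))) ?_).trans_lt measure_Icc_lt_top).ne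
      exact fun t h => ⟨h.1, h.2.1⟩
    · refine measure_mono_null (t := {x n}) ?_ (by simp)
      rintro t ⟨h1, h2⟩
      exact le_antisymm h1.2.1 h2.1
end

section
/- With the same data as in the horizontal-slice formula — N ≥ 1, x₀ < ⋯ < x_N, h_i = x_{i+1} − x_i, y_{i+1}^± = y_i^± + h_i·α_i^±, max(y_i⁻, y_{i+1}⁻) ≤ min(y_i⁺, y_{i+1}⁺) for each i, ℓ^± the piecewise linear interpolants and P = {(x, y) : x₀ ≤ x ≤ x_N, ℓ⁻(x) ≤ y ≤ ℓ⁺(x)} — the slice-length function ρ(y) = Leb¹{x : (x, y) ∈ P} is differentiable at every y outside the finite set {y_i⁻, y_i⁺ : 0 ≤ i ≤ N}, with derivative ρ′(y) = Σ_{i=0}^{N−1} [ |α_i⁻|⁻¹·𝟙⟦y_i⁻, y_{i+1}⁻⟧(y) − |α_i⁺|⁻¹·𝟙⟦y_i⁺, y_{i+1}⁺⟧(y) ], where terms with α_i^± = 0 are zero. (This is the piecewise-constant derivative formula for the Duistermaat–Heckman function ρ_K stated in the final theorem of the paper.) -/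
open MeasureTheory Set

lemma DH_aux_lower (a b u s : ℝ) (hab : a < b) (y : ℝ) (h1 : y ≠ u)
    (h2 : y ≠ u + (b - a) * s) :
    HasDerivAt (fun y' : ℝ => (volume {t : ℝ | a ≤ t ∧ t ≤ b ∧ u + s * (t - a) ≤ y'}).toReal)
      ((Set.uIcc u (u + (b - a) * s)).indicator (fun _ => |s|⁻¹) y) y := by
  have hb : 0 < b - a := sub_pos.2 hab
  by_cases hlo : y < min u (u + (b - a) * s)
  · have hni : y ∉ Set.uIcc u (u + (b - a) * s) := fun h => absurd h.1 (not_le.2 hlo)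
    rw [Set.indicator_of_notMem hni]
    refine (hasDerivAt_const y (0 : ℝ)).congr_of_eventuallyEq ?_
    filter_upwards [Iio_mem_nhds hlo] with y' hy'
    have : {t : ℝ | a ≤ t ∧ t ≤ b ∧ u + s * (t - a) ≤ y'} = ∅ := by
      ext t
      simp only [mem_ofPred_eq, mem_empty_iff_false, iff_false]
      rintro ⟨h3, h4, h5⟩
      have h6 := lt_min_iff.1 (mem_Iio.1 hy')
      rcases le_total 0 s with hs | hs
      · nlinarith [mul_nonneg hs (sub_nonneg.2 h3)]
      · nlinarith [mul_nonneg (neg_nonneg.2 hs) (sub_nonneg.2 h4)]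
    simp [this]
  by_cases hhi : max u (u + (b - a) * s) < y
  · have hni : y ∉ Set.uIcc u (u + (b - a) * s) := fun h => absurd h.2 (not_le.2 hhi)
    rw [Set.indicator_of_notMem hni]
    refine (hasDerivAt_const y ((volume (Icc a b)).toReal)).congr_of_eventuallyEq ?_
    filter_upwards [Ioi_mem_nhds hhi] with y' hy'
    have : {t : ℝ | a ≤ t ∧ t ≤ b ∧ u + s * (t - a) ≤ y'} = Icc a b := by
      ext t
      simp only [mem_ofPred_eq, mem_Icc]
      refine ⟨fun h => ⟨h.1, h.2.1⟩, fun h => ⟨h.1, h.2, ?_⟩⟩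
      obtain ⟨h3, h4⟩ := h
      have h6 := max_lt_iff.1 (mem_Ioi.1 hy')
      rcases le_total 0 s with hs | hs
      · nlinarith [mul_nonneg hs (sub_nonneg.2 h4)]
      · nlinarith [mul_nonneg (neg_nonneg.2 hs) (sub_nonneg.2 h3)]
    simp only [this]
  push Not at hlo hhi
  have hmem : y ∈ Set.uIcc u (u + (b - a) * s) := ⟨hlo, hhi⟩
  rw [Set.indicator_of_mem hmem]
  rcases lt_trichotomy s 0 with hs | hs | hs
  · have hle : u + (b - a) * s ≤ u := by nlinarith
    rw [min_eq_right hle] at hlo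
    rw [max_eq_left hle] at hhi
    have hlo' := lt_of_le_of_ne hlo (Ne.symm h2)
    have hhi' := lt_of_le_of_ne hhi h1
    have hd : HasDerivAt (fun y' : ℝ => b - (a + (y' - u) / s)) (|s|⁻¹) y := by
      have := ((((hasDerivAt_id y).sub_const u).div_const s).const_add a).const_sub b
      refine HasDerivAt.congr_deriv this ?_
      rw [abs_of_neg hs]; field_simp
    refine hd.congr_of_eventuallyEq ?_
    filter_upwards [Ioo_mem_nhds hlo' hhi'] with y' hy'
    have hq : (y' - u) / s * s = y' - u := div_mul_cancel₀ _ hs.ne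
    have : {t : ℝ | a ≤ t ∧ t ≤ b ∧ u + s * (t - a) ≤ y'} = Icc (a + (y' - u) / s) b := by
      ext t
      simp only [mem_ofPred_eq, mem_Icc]
      have hq0 : 0 < (y' - u) / s := div_pos_of_neg_of_neg (by linarith [hy'.2]) hs
      constructor
      · rintro ⟨h3, h4, h5⟩
        refine ⟨?_, h4⟩
        by_contra hc
        push Not at hc
        nlinarith
      · rintro ⟨h3, h4⟩
        refine ⟨by linarith, h4, ?_⟩
        nlinarith
    have hle2 : (y' - u) / s ≤ b - a := by
      rw [div_le_iff_of_neg hs]; linarith [hy'.1]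
    rw [this, Real.volume_Icc, ENNReal.toReal_ofReal (by linarith)]
  · subst hs
    simp only [mul_zero, add_zero, min_self, max_self] at hlo hhi
    exact absurd (le_antisymm hhi hlo) h1
  · have hle : u ≤ u + (b - a) * s := by nlinarith
    rw [min_eq_left hle] at hlo
    rw [max_eq_right hle] at hhi
    have hlo' := lt_of_le_of_ne hlo (Ne.symm h1)
    have hhi' := lt_of_le_of_ne hhi h2
    have hd : HasDerivAt (fun y' : ℝ => (a + (y' - u) / s) - a) (|s|⁻¹) y := by
      have := ((((hasDerivAt_id y).sub_const u).div_const s).const_add a).sub_const a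
      refine HasDerivAt.congr_deriv this ?_
      rw [abs_of_pos hs]; field_simp
    refine hd.congr_of_eventuallyEq ?_
    filter_upwards [Ioo_mem_nhds hlo' hhi'] with y' hy'
    have hq : (y' - u) / s * s = y' - u := div_mul_cancel₀ _ hs.ne'
    have hq0 : 0 < (y' - u) / s := div_pos (by linarith [hy'.1]) hs
    have hle2 : (y' - u) / s ≤ b - a := by
      rw [div_le_iff₀ hs]; linarith [hy'.2]
    have : {t : ℝ | a ≤ t ∧ t ≤ b ∧ u + s * (t - a) ≤ y'} = Icc a (a + (y' - u) / s) := by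
      ext t
      simp only [mem_ofPred_eq, mem_Icc]
      constructor
      · rintro ⟨h3, h4, h5⟩
        refine ⟨h3, ?_⟩
        by_contra hc
        push Not at hc
        nlinarith
      · rintro ⟨h3, h4⟩
        refine ⟨h3, by linarith, ?_⟩
        nlinarith
    rw [this, Real.volume_Icc, ENNReal.toReal_ofReal (by linarith)]

lemma DH_aux_upper (a b u s : ℝ) (hab : a < b) (y : ℝ) (h1 : y ≠ u)
    (h2 : y ≠ u + (b - a) * s) :
    HasDerivAt (fun y' : ℝ => (volume {t : ℝ | a ≤ t ∧ t ≤ b ∧ y' ≤ u + s * (t - a)}).toReal)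
      (-(Set.uIcc u (u + (b - a) * s)).indicator (fun _ => |s|⁻¹) y) y := by
  have h := DH_aux_lower a b (-u) (-s) hab (-y) (fun h => h1 (by linarith))
    (fun h => h2 (by linarith))
  have h' := HasDerivAt.comp y h (hasDerivAt_neg y)
  have e : (fun y' : ℝ => (volume {t : ℝ | a ≤ t ∧ t ≤ b ∧ y' ≤ u + s * (t - a)}).toReal)
      = (fun y' : ℝ => (volume {t : ℝ | a ≤ t ∧ t ≤ b ∧ -u + -s * (t - a) ≤ y'}).toReal) ∘
        (fun y' => -y') := by
    funext y'
    simp only [Function.comp]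
    congr 3
    ext t
    have : y' ≤ u + s * (t - a) ↔ -u + -s * (t - a) ≤ -y' := by
      constructor <;> intro h <;> linarith
    simp only [this]
  rw [e]
  refine HasDerivAt.congr_deriv h' ?_
  have hm : -y ∈ Set.uIcc (-u) (-u + (b - a) * -s) ↔ y ∈ Set.uIcc u (u + (b - a) * s) := by
    have : -u + (b - a) * -s = -(u + (b - a) * s) := by ring
    rw [this, Set.mem_uIcc, Set.mem_uIcc]
    simp only [neg_le_neg_iff]
    tauto
  by_cases hy : y ∈ Set.uIcc u (u + (b - a) * s)
  · rw [Set.indicator_of_mem hy, Set.indicator_of_mem (hm.2 hy)]; simp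
  · rw [Set.indicator_of_notMem hy, Set.indicator_of_notMem (fun h => hy (hm.1 h))]; simp

lemma DH_aux_affine_le (a b u s t : ℝ) (h3 : a ≤ t) (h4 : t ≤ b) :
    u + s * (t - a) ≤ max u (u + (b - a) * s) := by
  rcases le_total 0 s with hs | hs
  · apply le_max_of_le_right; nlinarith
  · apply le_max_of_le_left; nlinarith

lemma DH_aux_le_affine (a b u s t : ℝ) (h3 : a ≤ t) (h4 : t ≤ b) :
    min u (u + (b - a) * s) ≤ u + s * (t - a) := by
  rcases le_total 0 s with hs | hs
  · apply min_le_of_left_le; nlinarith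
  · apply min_le_of_right_le; nlinarith

lemma DH_aux_strip (a b u s v r : ℝ) (hab : a < b) (y : ℝ) (h1 : y ≠ u)
    (h2 : y ≠ u + (b - a) * s) (h3 : y ≠ v) (h4 : y ≠ v + (b - a) * r)
    (hband : max u (u + (b - a) * s) ≤ min v (v + (b - a) * r)) :
    HasDerivAt (fun y' : ℝ => (volume {t : ℝ | a ≤ t ∧ t ≤ b ∧ u + s * (t - a) ≤ y' ∧
        y' ≤ v + r * (t - a)}).toReal)
      ((Set.uIcc u (u + (b - a) * s)).indicator (fun _ => |s|⁻¹) y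
        - (Set.uIcc v (v + (b - a) * r)).indicator (fun _ => |r|⁻¹) y) y := by
  have hne : y ≠ max u (u + (b - a) * s) := by
    rcases max_choice u (u + (b - a) * s) with h | h <;> rw [h] <;> assumption
  rcases lt_or_gt_of_ne hne with h | h
  · have hni : y ∉ Set.uIcc v (v + (b - a) * r) :=
      fun h' => absurd h'.1 (not_le.2 (h.trans_le hband))
    rw [Set.indicator_of_notMem hni, sub_zero]
    refine (DH_aux_lower a b u s hab y h1 h2).congr_of_eventuallyEq ?_
    filter_upwards [Iio_mem_nhds h] with y' hy'
    congr 3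
    ext t
    refine ⟨fun h => ⟨h.1, h.2.1, h.2.2.1⟩, fun h => ⟨h.1, h.2.1, h.2.2, ?_⟩⟩
    exact (hy'.le.trans hband).trans (DH_aux_le_affine a b v r t h.1 h.2.1)
  · have hni : y ∉ Set.uIcc u (u + (b - a) * s) :=
      fun h' => absurd h'.2 (not_le.2 h)
    rw [Set.indicator_of_notMem hni, zero_sub]
    refine (DH_aux_upper a b v r hab y h3 h4).congr_of_eventuallyEq ?_
    filter_upwards [Ioi_mem_nhds h] with y' hy'
    congr 3
    ext t
    refine ⟨fun h => ⟨h.1, h.2.1, h.2.2.2⟩, fun h => ⟨h.1, h.2.1, ?_, h.2.2⟩⟩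
    exact (DH_aux_affine_le a b u s t h.1 h.2.1).trans (le_of_lt hy')

/-- The derivative of the Duistermaat–Heckman function `ρ_K` (final theorem of
the paper): with the same generalised-moment-polygon data as in the slice-length
formula, the slice-length function `ρ(y) = Leb¹{t : (t, y) ∈ P}` is
differentiable at every `y` avoiding the vertex ordinates, with
`ρ′(y) = Σ_i |α_i⁻|⁻¹ 𝟙⟦y_i⁻,y_{i+1}⁻⟧(y) − |α_i⁺|⁻¹ 𝟙⟦y_i⁺,y_{i+1}⁺⟧(y)`. -/
theorem DH_slice_length_deriv
    (N : ℕ) (hN : 1 ≤ N) (x ym yp am ap : ℕ → ℝ)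
    (hx : ∀ i < N, x i < x (i + 1))
    (hym : ∀ i < N, ym (i + 1) = ym i + (x (i + 1) - x i) * am i)
    (hyp : ∀ i < N, yp (i + 1) = yp i + (x (i + 1) - x i) * ap i)
    (hband : ∀ i < N, max (ym i) (ym (i + 1)) ≤ min (yp i) (yp (i + 1)))
    (ℓm ℓp : ℝ → ℝ)
    (hℓm : ∀ i < N, ∀ t ∈ Set.Icc (x i) (x (i + 1)), ℓm t = ym i + am i * (t - x i))
    (hℓp : ∀ i < N, ∀ t ∈ Set.Icc (x i) (x (i + 1)), ℓp t = yp i + ap i * (t - x i))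
    (y : ℝ) (hy : ∀ i ≤ N, y ≠ ym i ∧ y ≠ yp i) :
    HasDerivAt
      (fun y' : ℝ => (volume {t : ℝ | x 0 ≤ t ∧ t ≤ x N ∧ ℓm t ≤ y' ∧ y' ≤ ℓp t}).toReal)
      (∑ i ∈ Finset.range N,
        ((Set.uIcc (ym i) (ym (i + 1))).indicator (fun _ => |am i|⁻¹) y
          - (Set.uIcc (yp i) (yp (i + 1))).indicator (fun _ => |ap i|⁻¹) y))
      y := by
  have key : ∀ n ≤ N, x 0 ≤ x n ∧ HasDerivAt
      (fun y' : ℝ => (volume {t : ℝ | x 0 ≤ t ∧ t ≤ x n ∧ ℓm t ≤ y' ∧ y' ≤ ℓp t}).toReal)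
      (∑ i ∈ Finset.range n,
        ((Set.uIcc (ym i) (ym (i + 1))).indicator (fun _ => |am i|⁻¹) y
          - (Set.uIcc (yp i) (yp (i + 1))).indicator (fun _ => |ap i|⁻¹) y))
      y := by
    intro n
    induction n with
    | zero =>
      intro _
      refine ⟨le_rfl, ?_⟩
      simp only [Finset.range_zero, Finset.sum_empty]
      have e : (fun y' : ℝ =>
          (volume {t : ℝ | x 0 ≤ t ∧ t ≤ x 0 ∧ ℓm t ≤ y' ∧ y' ≤ ℓp t}).toReal)
          = fun _ => 0 := by
        funext y'
        have : volume {t : ℝ | x 0 ≤ t ∧ t ≤ x 0 ∧ ℓm t ≤ y' ∧ y' ≤ ℓp t} = 0 := by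
          refine measure_mono_null (t := {x 0}) ?_ Real.volume_singleton
          intro t ht
          exact le_antisymm ht.2.1 ht.1
        rw [this]; rfl
      rw [e]
      exact hasDerivAt_const y 0
    | succ n ih =>
      intro hn
      have hnN : n < N := hn
      obtain ⟨h0, ih⟩ := ih hnN.le
      have hxn := hx n hnN
      refine ⟨h0.trans hxn.le, ?_⟩
      rw [Finset.sum_range_succ]
      have hb := hband n hnN
      have hy0 := hy n hnN.le
      have hy1 := hy (n + 1) hn
      rw [hym n hnN, hyp n hnN] at hb hy1 ⊢
      have hs := DH_aux_strip (x n) (x (n + 1)) (ym n) (am n) (yp n) (ap n) hxn y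
        hy0.1 hy1.1 hy0.2 hy1.2 hb
      have hadd := ih.add hs
      refine hadd.congr_of_eventuallyEq (Filter.Eventually.of_forall fun y' => ?_)
      simp only [Pi.add_apply]
      set T : Set ℝ := {t : ℝ | x n ≤ t ∧ t ≤ x (n + 1) ∧ ym n + am n * (t - x n) ≤ y' ∧
        y' ≤ yp n + ap n * (t - x n)} with hT
      set S : Set ℝ := {t : ℝ | x 0 ≤ t ∧ t ≤ x n ∧ ℓm t ≤ y' ∧ y' ≤ ℓp t} with hS
      have hU : {t : ℝ | x 0 ≤ t ∧ t ≤ x (n + 1) ∧ ℓm t ≤ y' ∧ y' ≤ ℓp t} = S ∪ T := by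
        ext t
        simp only [hS, hT, mem_union, mem_ofPred_eq]
        constructor
        · rintro ⟨g1, g2, g3, g4⟩
          rcases le_total t (x n) with h | h
          · exact Or.inl ⟨g1, h, g3, g4⟩
          · rw [hℓm n hnN t ⟨h, g2⟩] at g3
            rw [hℓp n hnN t ⟨h, g2⟩] at g4
            exact Or.inr ⟨h, g2, g3, g4⟩
        · rintro (⟨g1, g2, g3, g4⟩ | ⟨g1, g2, g3, g4⟩)
          · exact ⟨g1, g2.trans hxn.le, g3, g4⟩
          · rw [← hℓm n hnN t ⟨g1, g2⟩] at g3
            rw [← hℓp n hnN t ⟨g1, g2⟩] at g4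
            exact ⟨h0.trans g1, g2, g3, g4⟩
      have hTm : MeasurableSet T := by
        have e : T = Icc (x n) (x (n + 1)) ∩ ({t : ℝ | ym n + am n * (t - x n) ≤ y'} ∩
            {t : ℝ | y' ≤ yp n + ap n * (t - x n)}) := by
          ext t
          simp only [hT, mem_inter_iff, mem_ofPred_eq, mem_Icc, and_assoc]
        rw [e]
        exact measurableSet_Icc.inter ((measurableSet_le (by fun_prop) (by fun_prop)).inter
          (measurableSet_le (by fun_prop) (by fun_prop)))
      have hdis : AEDisjoint volume S T := by
        refine measure_mono_null (t := {x n}) ?_ Real.volume_singleton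
        rintro t ⟨ht1, ht2⟩
        exact le_antisymm ht1.2.1 ht2.1
      have hSf : volume S ≠ ⊤ := by
        refine ((measure_mono (t := Icc (x 0) (x n)) ?_).trans_lt measure_Icc_lt_top).ne
        exact fun t ht => ⟨ht.1, ht.2.1⟩
      have hTf : volume T ≠ ⊤ := by
        refine ((measure_mono (t := Icc (x n) (x (n + 1))) ?_).trans_lt measure_Icc_lt_top).ne
        exact fun t ht => ⟨ht.1, ht.2.1⟩
      rw [hU, measure_union₀ hTm.nullMeasurableSet hdis, ENNReal.toReal_add hSf hTf]
  exact (key N le_rfl).2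
end
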